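/- arXiv:1610.02934 — 2 statements merged into one kernel-verified Lean document; each statement's English description precedes it below -/
import Mathlib

section
/- Let T be a triangulation of the completed ∞-gon and n ∈ ℤ. If the Prüfer curve π_n belongs to T, then T contains a right fountain at n or there exists m > n with π_m ∈ T. Dually, if the adic curve α_n belongs to T, then T contains a left fountain at n or there exists m < n with α_m ∈ T. -/
open scoped Classical

/-- Vertices of the completed ∞-gon: `ℤ ∪ {−∞, +∞}` with the extended linear order. -/
abbrev Vtx : Type := WithBot (WithTop ℤ)

/-- The vertex corresponding to an integer. -/
def vInt (m : ℤ) : Vtx := ((m : WithTop ℤ) : Vtx)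

/-- The vertex `+∞`. -/
def vTop : Vtx := ((⊤ : WithTop ℤ) : Vtx)

/-- The vertex `−∞`. -/
def vBot : Vtx := (⊥ : Vtx)

/-- An arc of the completed ∞-gon: a pair of vertices `src < tgt` such that if both
endpoints are integers then they differ by at least `2`. -/
structure Arc where
  src : Vtx
  tgt : Vtx
  lt : src < tgt
  sep : ∀ m n : ℤ, src = vInt m → tgt = vInt n → m + 2 ≤ n

/-- Two arcs `(a,b)` and `(c,d)` cross if `a < c < b < d` or `c < a < d < b`. -/
def Cross (x y : Arc) : Prop :=
  (x.src < y.src ∧ y.src < x.tgt ∧ x.tgt < y.tgt) ∨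
  (y.src < x.src ∧ x.src < y.tgt ∧ y.tgt < x.tgt)

/-- A triangulation of the completed ∞-gon: a maximal set of pairwise compatible
(= non-crossing) arcs. -/
def IsTriangulation (T : Set Arc) : Prop :=
  (∀ x ∈ T, ∀ y ∈ T, ¬ Cross x y) ∧
  ∀ γ : Arc, (∀ x ∈ T, ¬ Cross γ x) → γ ∈ T

lemma vInt_lt_vTop (m : ℤ) : vInt m < vTop := by
  simpa [vInt, vTop] using WithBot.coe_lt_coe.mpr (WithTop.coe_lt_top (m : ℤ))

lemma vBot_lt_vInt (m : ℤ) : vBot < vInt m := WithBot.bot_lt_coe _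

lemma vBot_lt_vTop : vBot < vTop := WithBot.bot_lt_coe _

lemma vTop_ne_vInt (n : ℤ) : vTop ≠ vInt n := by simp [vTop, vInt]

lemma vBot_ne_vInt (n : ℤ) : vBot ≠ vInt n := by simp [vBot, vInt]

/-- The Prüfer curve `π_m = (m, +∞)`. -/
def prufer (m : ℤ) : Arc :=
  ⟨vInt m, vTop, vInt_lt_vTop m, fun _ n _ h => absurd h (vTop_ne_vInt n)⟩

/-- The adic curve `α_m = (−∞, m)`. -/
def adic (m : ℤ) : Arc :=
  ⟨vBot, vInt m, vBot_lt_vInt m, fun k _ h _ => absurd h (vBot_ne_vInt k)⟩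

/-- The generic curve `z = (−∞, +∞)`. -/
def generic : Arc :=
  ⟨vBot, vTop, vBot_lt_vTop, fun k _ h _ => absurd h (vBot_ne_vInt k)⟩

/-- `T` contains an arc with endpoints `x` and `y`. -/
def HasArc (T : Set Arc) (x y : Vtx) : Prop := ∃ γ ∈ T, γ.src = x ∧ γ.tgt = y

/-- `T` has a right fountain at the integer `n`. -/
def RightFountainInt (T : Set Arc) (n : ℤ) : Prop :=
  {p : ℤ | HasArc T (vInt n) (vInt p)}.Infinite

/-- `T` has a left fountain at the integer `n`. -/
def LeftFountainInt (T : Set Arc) (n : ℤ) : Prop :=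
  {p : ℤ | HasArc T (vInt p) (vInt n)}.Infinite

/-- `T` has a right fountain at the vertex `v`. -/
def RightFountain (T : Set Arc) (v : Vtx) : Prop :=
  (∃ n : ℤ, v = vInt n ∧ RightFountainInt T n) ∨
  (v = vTop ∧ {p : ℤ | 0 ≤ p ∧ prufer p ∈ T}.Infinite) ∨
  (v = vBot ∧ {p : ℤ | 0 ≤ p ∧ adic p ∈ T}.Infinite)

/-- `T` has a left fountain at the vertex `v`. -/
def LeftFountain (T : Set Arc) (v : Vtx) : Prop :=
  (∃ n : ℤ, v = vInt n ∧ LeftFountainInt T n) ∨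
  (v = vTop ∧ {p : ℤ | p ≤ 0 ∧ prufer p ∈ T}.Infinite) ∨
  (v = vBot ∧ {p : ℤ | p ≤ 0 ∧ adic p ∈ T}.Infinite)

/-- `T` is locally finite if every vertex is an endpoint of only finitely many arcs of `T`. -/
def LocallyFin (T : Set Arc) : Prop :=
  ∀ v : Vtx, {γ | γ ∈ T ∧ (γ.src = v ∨ γ.tgt = v)}.Finite

/-- An arc is peripheral if both endpoints are integers. -/
def IsPeripheral (γ : Arc) : Prop :=
  (∃ m : ℤ, γ.src = vInt m) ∧ ∃ n : ℤ, γ.tgt = vInt n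

/-- `γ'` is an exchange partner for `γ` relative to `T`:
it is distinct from `γ` and `(T \ {γ}) ∪ {γ'}` is again a triangulation. -/
def MutExchange (T : Set Arc) (γ γ' : Arc) : Prop :=
  γ' ≠ γ ∧ IsTriangulation ((T \ {γ}) ∪ {γ'})

/-- `γ` is a mutable arc of `T`. -/
def IsMutable (T : Set Arc) (γ : Arc) : Prop :=
  γ ∈ T ∧ ∃ γ', MutExchange T γ γ'

/-- The (unique) replacement arc of `γ` in `T`, when `γ` is mutable. -/
noncomputable def flipArc (T : Set Arc) (γ : Arc) : Arc :=
  if h : ∃ γ', MutExchange T γ γ' then h.choose else γ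

/-- The mutation `μ_γ(T)` of `T` at `γ`. -/
noncomputable def mutate (T : Set Arc) (γ : Arc) : Set Arc :=
  (T \ {γ}) ∪ {flipArc T γ}

/-- `μ_γ(δ)`: the effect of the mutation of `T` at `γ` on the arc `δ`. -/
noncomputable def mutArc (T : Set Arc) (γ δ : Arc) : Arc :=
  if δ = γ then flipArc T γ else δ

/-- One step of a mutation sequence on a set of arcs (`none` = no entry). -/
noncomputable def stepT (T : Set Arc) : Option Arc → Set Arc
  | none => T
  | some γ => mutate T γ

/-- One step of a mutation sequence on a single arc. -/
noncomputable def stepA (T : Set Arc) : Option Arc → Arc → Arc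
  | none, δ => δ
  | some γ, δ => mutArc T γ δ

/-- `iterT T θ k` is `μ_{θ_k} ∘ ⋯ ∘ μ_{θ_1}(T)`. Sequences (finite or infinite) are
encoded as `θ : ℕ → Option Arc` whose support is downward closed. -/
noncomputable def iterT (T : Set Arc) (θ : ℕ → Option Arc) : ℕ → Set Arc
  | 0 => T
  | k + 1 => stepT (iterT T θ k) (θ k)

/-- `iterA T θ γ k` is `μ_{θ_k} ∘ ⋯ ∘ μ_{θ_1}(γ)`. -/
noncomputable def iterA (T : Set Arc) (θ : ℕ → Option Arc) (γ : Arc) : ℕ → Arc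
  | 0 => γ
  | k + 1 => stepA (iterT T θ k) (θ k) (iterA T θ γ k)

/-- `θ` is a `T`-admissible sequence: its support is downward closed (so it is a genuine
finite or infinite sequence), each entry is mutable in the triangulation obtained by the
previous mutations, and the mutation of each arc of `T` along `θ` eventually stabilizes. -/
def Admissible (T : Set Arc) (θ : ℕ → Option Arc) : Prop :=
  (∀ i, θ i = none → θ (i + 1) = none) ∧
  (∀ i γ, θ i = some γ → IsMutable (iterT T θ i) γ) ∧
  (∀ γ ∈ T, ∃ l, ∀ k, l ≤ k → iterA T θ γ k = iterA T θ γ l)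

/-- `μ_θ(γ)`: the stable value of the mutation of the arc `γ` along the sequence `θ`. -/
noncomputable def seqLimit (T : Set Arc) (θ : ℕ → Option Arc) (γ : Arc) : Arc :=
  if h : ∃ l, ∀ k, l ≤ k → iterA T θ γ k = iterA T θ γ l
  then iterA T θ γ h.choose else γ

/-- `μ_θ(T)`: the mutation of `T` along the sequence `θ`. -/
noncomputable def mutSeq (T : Set Arc) (θ : ℕ → Option Arc) : Set Arc :=
  seqLimit T θ '' T

/-- The sequence `θ` leaves the arc `γ` untouched. -/
def Untouched (T : Set Arc) (θ : ℕ → Option Arc) (γ : Arc) : Prop :=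
  ∀ l, iterA T θ γ l = γ

/-- The quadrilateral `S(γ)` of a mutable arc `γ` in `T`: with `v₁ < v₂ < v₃ < v₄` the four
endpoints of the two diagonals `γ` and `flipArc T γ`, it consists of those of the pairs
`(v₁,v₂), (v₂,v₃), (v₃,v₄), (v₁,v₄)` that are arcs. -/
noncomputable def quad (T : Set Arc) (γ : Arc) : Set Arc :=
  let γ' := flipArc T γ
  let vs : Vtx × Vtx × Vtx × Vtx :=
    if γ.src < γ'.src then (γ.src, γ'.src, γ.tgt, γ'.tgt) else (γ'.src, γ.src, γ'.tgt, γ.tgt)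
  {δ : Arc | (δ.src = vs.1 ∧ δ.tgt = vs.2.1) ∨ (δ.src = vs.2.1 ∧ δ.tgt = vs.2.2.1) ∨
    (δ.src = vs.2.2.1 ∧ δ.tgt = vs.2.2.2) ∨ (δ.src = vs.1 ∧ δ.tgt = vs.2.2.2)}

/-- The set `𝒫` of Prüfer curves compatible with every arc of `S`. -/
def pruferCompletion (S : Set Arc) : Set Arc :=
  {γ | (∃ k : ℤ, γ = prufer k) ∧ ∀ x ∈ S, ¬ Cross γ x}

/-- The set `𝒜̃` of adic curves compatible with every arc of `S ∪ 𝒫(S)`. -/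
def adicCompletion' (S : Set Arc) : Set Arc :=
  {γ | (∃ k : ℤ, γ = adic k) ∧ ∀ x ∈ S ∪ pruferCompletion S, ¬ Cross γ x}

/-- The completed (Prüfer) mutation `μ̄_θ(T) = μ_θ(T) ∪ 𝒫 ∪ 𝒜̃` of `T` along `θ`. -/
noncomputable def completedMut (T : Set Arc) (θ : ℕ → Option Arc) : Set Arc :=
  mutSeq T θ ∪ pruferCompletion (mutSeq T θ) ∪ adicCompletion' (mutSeq T θ)

/-- The tower of triangulations associated to a composition of completed mutations. -/
noncomputable def compIter (T : Set Arc) (Θ : ℕ → Option (ℕ → Option Arc)) : ℕ → Set Arc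
  | 0 => T
  | k + 1 =>
    match Θ k with
    | none => compIter T Θ k
    | some θ => completedMut (compIter T Θ k) θ

/-- `Θ` is a `T`-admissible composition of completed mutations. -/
def CompAdmissible (T : Set Arc) (Θ : ℕ → Option (ℕ → Option Arc)) : Prop :=
  (∀ i, Θ i = none → Θ (i + 1) = none) ∧
  ∀ i θ, Θ i = some θ → Admissible (compIter T Θ i) θ

/-- The transfinite mutation of `T` along the composition `Θ`. -/
noncomputable def transfiniteMut (T : Set Arc) (Θ : ℕ → Option (ℕ → Option Arc)) : Set Arc :=
  ⋃ i, {γ ∈ compIter T Θ i |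
    ∀ k, i ≤ k → ∀ θ, Θ k = some θ → Untouched (compIter T Θ k) θ γ}

lemma vInt_lt_iff (a b : ℤ) : vInt a < vInt b ↔ a < b := by simp [vInt]

lemma vtx_cases (v : Vtx) : v = vBot ∨ (∃ m : ℤ, v = vInt m) ∨ v = vTop := by
  induction v using WithBot.recBotCoe with
  | bot => exact Or.inl rfl
  | coe w =>
    induction w using WithTop.recTopCoe with
    | top => exact Or.inr (Or.inr rfl)
    | coe m => exact Or.inr (Or.inl ⟨m, rfl⟩)

lemma not_vTop_lt (v : Vtx) : ¬ vTop < v := by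
  rcases vtx_cases v with rfl | ⟨m, rfl⟩ | rfl
  · exact vBot_lt_vTop.asymm
  · exact (vInt_lt_vTop m).asymm
  · exact lt_irrefl _

lemma not_lt_vBot (v : Vtx) : ¬ v < vBot := by simp [vBot]

lemma prufer_step (T : Set Arc) (hT : IsTriangulation T) (n : ℤ) (hn : prufer n ∈ T) :
    RightFountainInt T n ∨ ∃ m : ℤ, n < m ∧ prufer m ∈ T := by
  refine or_iff_not_imp_left.mpr fun hf => ?_
  have hfin : {p : ℤ | HasArc T (vInt n) (vInt p)}.Finite := Set.not_infinite.mp hf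
  obtain ⟨m, hm, hmax⟩ := Set.exists_max_image (insert (n + 1) _) id (hfin.insert (n + 1))
    ⟨n + 1, Set.mem_insert _ _⟩
  simp only [id] at hmax
  have h1 : n + 1 ≤ m := hmax _ (Set.mem_insert _ _)
  refine ⟨m, by omega, hT.2 _ fun x hx hc => ?_⟩
  rcases hc with ⟨_, _, h⟩ | ⟨ha, hb, hd⟩
  · exact not_vTop_lt _ h
  simp only [prufer] at ha hb hd
  have hnm : vInt n < vInt m := (vInt_lt_iff _ _).2 (by omega)
  have hge : ¬ x.src < vInt n := fun h =>
    hT.1 _ hx _ hn (Or.inl ⟨h, hnm.trans hb, hd⟩)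
  rcases vtx_cases x.tgt with h | ⟨d, hd'⟩ | h
  · exact not_lt_vBot _ (h ▸ hb)
  · rw [hd', vInt_lt_iff] at hb
    rcases eq_or_lt_of_le (not_lt.mp hge) with he | hl
    · have := hmax d (Set.mem_insert_of_mem _ ⟨x, hx, he.symm, hd'⟩)
      omega
    · rcases hm with rfl | ⟨y, hy, hys, hyt⟩
      · rcases vtx_cases x.src with h | ⟨c, hc⟩ | h
        · exact not_lt_vBot _ (h ▸ hl)
        · rw [hc, vInt_lt_iff] at hl ha
          omega
        · exact not_vTop_lt _ (h ▸ ha)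
      · refine hT.1 _ hy _ hx (Or.inl ⟨hys ▸ hl, hyt ▸ ha, ?_⟩)
        rw [hyt, hd', vInt_lt_iff]
        exact hb
  · exact not_vTop_lt _ (h ▸ hd)

lemma adic_step (T : Set Arc) (hT : IsTriangulation T) (n : ℤ) (hn : adic n ∈ T) :
    LeftFountainInt T n ∨ ∃ m : ℤ, m < n ∧ adic m ∈ T := by
  refine or_iff_not_imp_left.mpr fun hf => ?_
  have hfin : {p : ℤ | HasArc T (vInt p) (vInt n)}.Finite := Set.not_infinite.mp hf
  obtain ⟨m, hm, hmin⟩ := Set.exists_min_image (insert (n - 1) _) id (hfin.insert (n - 1))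
    ⟨n - 1, Set.mem_insert _ _⟩
  simp only [id] at hmin
  have h1 : m ≤ n - 1 := hmin _ (Set.mem_insert _ _)
  refine ⟨m, by omega, hT.2 _ fun x hx hc => ?_⟩
  rcases hc with ⟨ha, hb, hd⟩ | ⟨h, _, _⟩
  swap
  · exact not_lt_vBot _ h
  simp only [adic] at ha hb hd
  have hnm : vInt m < vInt n := (vInt_lt_iff _ _).2 (by omega)
  have hge : ¬ vInt n < x.tgt := fun h =>
    hT.1 _ hn _ hx (Or.inl ⟨ha, hb.trans hnm, h⟩)
  rcases vtx_cases x.src with h | ⟨c, hc'⟩ | h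
  · exact not_lt_vBot _ (h ▸ ha)
  · rw [hc', vInt_lt_iff] at hb
    rcases eq_or_lt_of_le (not_lt.mp hge) with he | hl
    · have := hmin c (Set.mem_insert_of_mem _ ⟨x, hx, hc', he⟩)
      omega
    · rcases hm with rfl | ⟨y, hy, hys, hyt⟩
      · rcases vtx_cases x.tgt with h | ⟨d, hd'⟩ | h
        · exact not_lt_vBot _ (h ▸ hd)
        · rw [hd', vInt_lt_iff] at hl hd
          omega
        · exact not_vTop_lt _ (h ▸ hl)
      · refine hT.1 _ hx _ hy (Or.inl ⟨?_, hys ▸ hd, hyt ▸ hl⟩)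
        rw [hys, hc', vInt_lt_iff]
        exact hb
  · exact not_vTop_lt _ (h ▸ hb)

/-- If `π_n ∈ T` then `T` has a right fountain at `n` or `π_m ∈ T` for some `m > n`;
dually, if `α_n ∈ T` then `T` has a left fountain at `n` or `α_m ∈ T` for some `m < n`. -/
theorem statement2 (T : Set Arc) (hT : IsTriangulation T) (n : ℤ) :
    (prufer n ∈ T → RightFountainInt T n ∨ ∃ m : ℤ, n < m ∧ prufer m ∈ T) ∧
    (adic n ∈ T → LeftFountainInt T n ∨ ∃ m : ℤ, m < n ∧ adic m ∈ T) := by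
  exact ⟨prufer_step T hT n, adic_step T hT n⟩
end

section
/- Let T be a triangulation of the ∞-gon and let α ∈ T be mutable. Then an arc γ ∈ T is mutable in T if and only if μ_α(γ) is mutable in μ_α(T). -/
open scoped Classical

/-- An arc of the ∞-gon: a pair of integers `(i,j)` with `i ≤ j − 2`. -/
structure ArcZ where
  src : ℤ
  tgt : ℤ
  sep : src + 2 ≤ tgt

/-- Two arcs `(i,j)` and `(k,l)` cross if `i < k < j < l` or `k < i < l < j`. -/
def CrossZ (x y : ArcZ) : Prop :=
  (x.src < y.src ∧ y.src < x.tgt ∧ x.tgt < y.tgt) ∨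
  (y.src < x.src ∧ x.src < y.tgt ∧ y.tgt < x.tgt)

/-- A triangulation of the ∞-gon: a maximal set of pairwise compatible
(= non-crossing) arcs. -/
def IsTriangulationZ (T : Set ArcZ) : Prop :=
  (∀ x ∈ T, ∀ y ∈ T, ¬ CrossZ x y) ∧
  ∀ γ : ArcZ, (∀ x ∈ T, ¬ CrossZ γ x) → γ ∈ T

/-- `T` has a right fountain at `n`. -/
def RightFountainZ (T : Set ArcZ) (n : ℤ) : Prop :=
  {p : ℤ | ∃ γ ∈ T, γ.src = n ∧ γ.tgt = p}.Infinite

/-- `T` has a left fountain at `n`. -/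
def LeftFountainZ (T : Set ArcZ) (n : ℤ) : Prop :=
  {p : ℤ | ∃ γ ∈ T, γ.src = p ∧ γ.tgt = n}.Infinite

/-- `T` is locally finite if every integer is an endpoint of only finitely many arcs of `T`. -/
def LocallyFinZ (T : Set ArcZ) : Prop :=
  ∀ v : ℤ, {γ | γ ∈ T ∧ (γ.src = v ∨ γ.tgt = v)}.Finite

/-- `γ'` is an exchange partner for `γ` relative to `T`:
it is distinct from `γ` and `(T \ {γ}) ∪ {γ'}` is again a triangulation. -/
def MutExchangeZ (T : Set ArcZ) (γ γ' : ArcZ) : Prop :=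
  γ' ≠ γ ∧ IsTriangulationZ ((T \ {γ}) ∪ {γ'})

/-- `γ` is a mutable arc of `T`. -/
def IsMutableZ (T : Set ArcZ) (γ : ArcZ) : Prop :=
  γ ∈ T ∧ ∃ γ', MutExchangeZ T γ γ'

/-- The (unique) replacement arc of `γ` in `T`, when `γ` is mutable. -/
noncomputable def flipArcZ (T : Set ArcZ) (γ : ArcZ) : ArcZ :=
  if h : ∃ γ', MutExchangeZ T γ γ' then h.choose else γ

/-- The mutation `μ_γ(T)` of `T` at `γ`. -/
noncomputable def mutateZ (T : Set ArcZ) (γ : ArcZ) : Set ArcZ :=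
  (T \ {γ}) ∪ {flipArcZ T γ}

/-- `μ_γ(δ)`: the effect of the mutation of `T` at `γ` on the arc `δ`. -/
noncomputable def mutArcZ (T : Set ArcZ) (γ δ : ArcZ) : ArcZ :=
  if δ = γ then flipArcZ T γ else δ

/-- One step of a mutation sequence on a set of arcs (`none` = no entry). -/
noncomputable def stepTZ (T : Set ArcZ) : Option ArcZ → Set ArcZ
  | none => T
  | some γ => mutateZ T γ

/-- One step of a mutation sequence on a single arc. -/
noncomputable def stepAZ (T : Set ArcZ) : Option ArcZ → ArcZ → ArcZ
  | none, δ => δ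
  | some γ, δ => mutArcZ T γ δ

/-- `iterTZ T θ k` is `μ_{θ_k} ∘ ⋯ ∘ μ_{θ_1}(T)`. Sequences (finite or infinite) are
encoded as `θ : ℕ → Option ArcZ` whose support is downward closed. -/
noncomputable def iterTZ (T : Set ArcZ) (θ : ℕ → Option ArcZ) : ℕ → Set ArcZ
  | 0 => T
  | k + 1 => stepTZ (iterTZ T θ k) (θ k)

/-- `iterAZ T θ γ k` is `μ_{θ_k} ∘ ⋯ ∘ μ_{θ_1}(γ)`. -/
noncomputable def iterAZ (T : Set ArcZ) (θ : ℕ → Option ArcZ) (γ : ArcZ) : ℕ → ArcZ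
  | 0 => γ
  | k + 1 => stepAZ (iterTZ T θ k) (θ k) (iterAZ T θ γ k)

/-- `θ` is a `T`-admissible sequence: its support is downward closed (so it is a genuine
finite or infinite sequence), each entry is mutable in the triangulation obtained by the
previous mutations, and the mutation of each arc of `T` along `θ` eventually stabilizes. -/
def AdmissibleZ (T : Set ArcZ) (θ : ℕ → Option ArcZ) : Prop :=
  (∀ i, θ i = none → θ (i + 1) = none) ∧
  (∀ i γ, θ i = some γ → IsMutableZ (iterTZ T θ i) γ) ∧
  (∀ γ ∈ T, ∃ l, ∀ k, l ≤ k → iterAZ T θ γ k = iterAZ T θ γ l)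

/-- `μ_θ(γ)`: the stable value of the mutation of the arc `γ` along the sequence `θ`. -/
noncomputable def seqLimitZ (T : Set ArcZ) (θ : ℕ → Option ArcZ) (γ : ArcZ) : ArcZ :=
  if h : ∃ l, ∀ k, l ≤ k → iterAZ T θ γ k = iterAZ T θ γ l
  then iterAZ T θ γ h.choose else γ

/-- `μ_θ(T)`: the mutation of `T` along the sequence `θ`. -/
noncomputable def mutSeqZ (T : Set ArcZ) (θ : ℕ → Option ArcZ) : Set ArcZ :=
  seqLimitZ T θ '' T

/-- The sequence `θ` leaves the arc `γ` untouched. -/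
def UntouchedZ (T : Set ArcZ) (θ : ℕ → Option ArcZ) (γ : ArcZ) : Prop :=
  ∀ l, iterAZ T θ γ l = γ

/-- The quadrilateral `S(γ)` of a mutable arc `γ` in `T`: with `v₁ < v₂ < v₃ < v₄` the four
endpoints of the two diagonals `γ` and `flipArcZ T γ`, it consists of those of the pairs
`(v₁,v₂), (v₂,v₃), (v₃,v₄), (v₁,v₄)` that are arcs. -/
noncomputable def quadZ (T : Set ArcZ) (γ : ArcZ) : Set ArcZ :=
  let γ' := flipArcZ T γ
  let vs : ℤ × ℤ × ℤ × ℤ :=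
    if γ.src < γ'.src then (γ.src, γ'.src, γ.tgt, γ'.tgt) else (γ'.src, γ.src, γ'.tgt, γ.tgt)
  {δ : ArcZ | (δ.src = vs.1 ∧ δ.tgt = vs.2.1) ∨ (δ.src = vs.2.1 ∧ δ.tgt = vs.2.2.1) ∨
    (δ.src = vs.2.2.1 ∧ δ.tgt = vs.2.2.2) ∨ (δ.src = vs.1 ∧ δ.tgt = vs.2.2.2)}

/-- The restriction `T|_S` of a set of arcs to a set `S` of vertices. -/
def restrictZ (T : Set ArcZ) (S : Set ℤ) : Set ArcZ :=
  {γ | γ ∈ T ∧ γ.src ∈ S ∧ γ.tgt ∈ S}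

/-- `T ≤_s T'`: there is a `T`-admissible sequence `θ` with `μ_θ(T) = T'`. -/
def leS (T T' : Set ArcZ) : Prop :=
  ∃ θ : ℕ → Option ArcZ, AdmissibleZ T θ ∧ mutSeqZ T θ = T'

theorem arcZ_ext {x y : ArcZ} (h1 : x.src = y.src) (h2 : x.tgt = y.tgt) : x = y := by
  cases x; cases y; simp_all

/-- `(p,q)` is an edge of the ∞-gon or crosses no arc of `T`. -/
def SideZ (T : Set ArcZ) (p q : ℤ) : Prop :=
  p < q ∧ ∀ x ∈ T, ¬ ((p < x.src ∧ x.src < q ∧ q < x.tgt) ∨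
    (x.src < p ∧ p < x.tgt ∧ x.tgt < q))

theorem sideZ_mem {T : Set ArcZ} (hT : IsTriangulationZ T) {p q : ℤ} (h : SideZ T p q)
    (hpq : p + 2 ≤ q) : (⟨p, q, hpq⟩ : ArcZ) ∈ T :=
  hT.2 _ (fun x hx hc => h.2 x hx hc)

/-- An arc of `T` has a triangle of `T` below it. -/
theorem tri_below {T : Set ArcZ} (hT : IsTriangulationZ T) {γ : ArcZ} (hγ : γ ∈ T) :
    ∃ m, SideZ T γ.src m ∧ SideZ T m γ.tgt := by
  have hsep := γ.sep
  have h0 : SideZ T γ.src (γ.src + 1) := ⟨by omega, fun x _ h => by have := x.sep; omega⟩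
  obtain ⟨m, ⟨hm, hmt⟩, hmax⟩ := Int.exists_greatest_of_bdd
    (P := fun m => SideZ T γ.src m ∧ m < γ.tgt) ⟨γ.tgt, fun z hz => hz.2.le⟩
    ⟨γ.src + 1, h0, by omega⟩
  refine ⟨m, hm, hmt, fun x hx h => ?_⟩
  have h1 := hm.2 x hx
  have h2 : ¬ CrossZ γ x := hT.1 γ hγ x hx
  have hs := x.sep
  have hp := hm.1
  unfold CrossZ at h2
  have hsrc : x.src = γ.src := by omega
  have := hmax x.tgt ⟨⟨by omega, fun y hy hc => hT.1 x hx y hy (by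
    unfold CrossZ; omega)⟩, by omega⟩
  omega

/-- If `γ'` crosses `γ` and nothing else in `T`, then it is an exchange partner. -/
theorem exch_of_cross {T : Set ArcZ} (hT : IsTriangulationZ T) {γ γ' : ArcZ} (hγ : γ ∈ T)
    (hc : CrossZ γ' γ) (ho : ∀ x ∈ T, CrossZ γ' x → x = γ) : MutExchangeZ T γ γ' := by
  have symm : ∀ x y, CrossZ x y → CrossZ y x := by
    intro x y h; unfold CrossZ at *; omega
  have irr : ∀ x, ¬ CrossZ x x := by
    intro x h; unfold CrossZ at *; omega
  refine ⟨fun h => irr γ (h ▸ hc), ?_, ?_⟩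
  · rintro x (⟨hx, hxn⟩ | rfl) y (⟨hy, hyn⟩ | rfl) h
    · exact hT.1 x hx y hy h
    · exact hxn (ho x hx (symm _ _ h))
    · exact hyn (ho y hy h)
    · exact irr _ h
  · intro δ hδ
    by_cases hδT : δ ∈ T
    · left
      refine ⟨hδT, fun h => hδ γ' (Or.inr rfl) ?_⟩
      rw [show δ = γ from h]
      exact symm _ _ hc
    · right
      have hδγ : CrossZ δ γ := by
        by_contra hn
        refine hδT (hT.2 δ fun x hx => ?_)
        by_cases hxγ : x = γ
        · rwa [hxγ]
        · exact hδ x (Or.inl ⟨hx, hxγ⟩)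
      have hδγ' := hδ γ' (Or.inr rfl)
      -- a side of the quadrilateral is not crossed by `δ`
      have key : ∀ p q : ℤ, p < q → (p = γ.src ∨ p = γ.tgt ∨ q = γ.src ∨ q = γ.tgt) →
          (∀ x : ArcZ, ¬ CrossZ γ x → ¬ CrossZ γ' x → ¬ ((p < x.src ∧ x.src < q ∧ q < x.tgt) ∨
            (x.src < p ∧ p < x.tgt ∧ x.tgt < q))) →
          (p ≠ γ.src ∨ q ≠ γ.tgt) →
          ¬ ((p < δ.src ∧ δ.src < q ∧ q < δ.tgt) ∨ (δ.src < p ∧ p < δ.tgt ∧ δ.tgt < q)) := by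
        intro p q hpq hend hx hne hcr
        have hside : SideZ T p q := ⟨hpq, fun x hxT h => by
          by_cases hxγ : x = γ
          · subst hxγ; omega
          · exact hx x (hT.1 γ hγ x hxT) (fun h => hxγ (ho x hxT h)) h⟩
        have hs := δ.sep
        have hl : p + 2 ≤ q := by omega
        refine hδ ⟨p, q, hl⟩ (Or.inl ⟨sideZ_mem hT hside hl, ?_⟩) ?_
        · intro h
          have h : (⟨p, q, hl⟩ : ArcZ) = γ := h
          rw [← h] at hne
          simp at hne
        · unfold CrossZ; simp only; omega
      have s1 := γ.sep
      have s2 := γ'.sep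
      have s3 := δ.sep
      unfold CrossZ at hc hδγ hδγ' key
      rcases hc with hc | hc
      · have k1 := key γ'.src γ.src (by omega) (by omega) (by intros; omega) (by omega)
        have k2 := key γ.src γ'.tgt (by omega) (by omega) (by intros; omega) (by omega)
        have k3 := key γ'.tgt γ.tgt (by omega) (by omega) (by intros; omega) (by omega)
        have k4 := key γ'.src γ.tgt (by omega) (by omega) (by intros; omega) (by omega)
        exact arcZ_ext (by omega) (by omega)
      · have k1 := key γ.src γ'.src (by omega) (by omega) (by intros; omega) (by omega)
        have k2 := key γ'.src γ.tgt (by omega) (by omega) (by intros; omega) (by omega)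
        have k3 := key γ.tgt γ'.tgt (by omega) (by omega) (by intros; omega) (by omega)
        have k4 := key γ.src γ'.tgt (by omega) (by omega) (by intros; omega) (by omega)
        exact arcZ_ext (by omega) (by omega)

theorem cross_of_exch {T : Set ArcZ} (hT : IsTriangulationZ T) {γ γ' : ArcZ} (hγ : γ ∈ T)
    (h : MutExchangeZ T γ γ') :
    γ' ∉ T ∧ CrossZ γ' γ ∧ ∀ x ∈ T, CrossZ γ' x → x = γ := by
  obtain ⟨hne, hT'⟩ := h
  have ho : ∀ x ∈ T, CrossZ γ' x → x = γ := by
    intro x hx hc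
    by_contra hn
    exact hT'.1 γ' (Or.inr rfl) x (Or.inl ⟨hx, hn⟩) hc
  have hnot : γ' ∉ T := by
    intro hm
    have : γ ∈ (T \ {γ}) ∪ {γ'} := hT'.2 γ (by
      rintro x (hx | rfl)
      · exact hT.1 γ hγ x hx.1
      · exact hT.1 γ hγ _ hm)
    rcases this with h | h
    · exact h.2 rfl
    · exact hne h.symm
  refine ⟨hnot, ?_, ho⟩
  by_contra hn
  refine hnot (hT.2 γ' fun x hx hc => ?_)
  rw [ho x hx hc] at hc
  exact hn hc

/-- An arc is mutable iff another arc of `T` passes over it. -/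
theorem mutable_iff {T : Set ArcZ} (hT : IsTriangulationZ T) {γ : ArcZ} (hγ : γ ∈ T) :
    IsMutableZ T γ ↔ ∃ δ ∈ T, δ ≠ γ ∧ δ.src ≤ γ.src ∧ γ.tgt ≤ δ.tgt := by
  have s1 := γ.sep
  constructor
  · rintro ⟨-, γ', h⟩
    obtain ⟨-, hc, ho⟩ := cross_of_exch hT hγ h
    have s2 := γ'.sep
    have hl : min γ.src γ'.src + 2 ≤ max γ.tgt γ'.tgt := by omega
    refine ⟨⟨min γ.src γ'.src, max γ.tgt γ'.tgt, hl⟩, hT.2 _ ?_, ?_, ?_, ?_⟩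
    · intro x hx hcx
      have h1 := hT.1 γ hγ x hx
      have s3 := x.sep
      by_cases hxγ : x = γ
      · subst hxγ
        unfold CrossZ at hc hcx; simp only at hcx; omega
      · have h2 : ¬ CrossZ γ' x := fun h => hxγ (ho x hx h)
        unfold CrossZ at hc hcx h1 h2; simp only at hcx; omega
    · intro h
      have e1 := congrArg ArcZ.src h
      have e2 := congrArg ArcZ.tgt h
      unfold CrossZ at hc; simp only at e1 e2; omega
    · simp
    · simp
  · intro hex
    have hex' : ∃ n : ℕ, ∃ δ ∈ T, δ ≠ γ ∧ δ.src ≤ γ.src ∧ γ.tgt ≤ δ.tgt ∧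
        (δ.tgt - δ.src).toNat = n := by
      obtain ⟨δ, a, b, c, d⟩ := hex
      exact ⟨_, δ, a, b, c, d, rfl⟩
    obtain ⟨δ, hδ, hne, hs, ht, hn⟩ := Nat.find_spec hex'
    have hmin : ∀ ε ∈ T, ε.src ≤ γ.src → γ.tgt ≤ ε.tgt → δ.src ≤ ε.src → ε.tgt ≤ δ.tgt →
        δ.src < ε.src ∨ ε.tgt < δ.tgt → ε = γ := by
      intro ε hε h1 h2 h3 h4 h5
      by_contra hn'
      have := Nat.find_min' hex' ⟨ε, hε, hn', h1, h2, rfl⟩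
      rw [← hn] at this
      have := ε.sep
      omega
    have hne' : δ.src ≠ γ.src ∨ δ.tgt ≠ γ.tgt := by
      by_contra h
      push Not at h
      exact hne (arcZ_ext h.1 h.2)
    obtain ⟨m, hm1, hm2⟩ := tri_below hT hδ
    obtain ⟨n, hn1, hn2⟩ := tri_below hT hγ
    have c1 := hm1.2 γ hγ
    have c2 := hm2.2 γ hγ
    have p1 := hm1.1
    have p2 := hm2.1
    have p3 := hn1.1
    have p4 := hn2.1
    have hcase : (γ.src = δ.src ∧ γ.tgt = m) ∨ (γ.src = m ∧ γ.tgt = δ.tgt) := by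
      rcases le_or_gt γ.tgt m with h | h
      · have hl : δ.src + 2 ≤ m := by omega
        have := hmin _ (sideZ_mem hT hm1 hl) hs h le_rfl p2.le (Or.inr p2)
        rw [← this]; simp
      · have hl : m + 2 ≤ δ.tgt := by omega
        have := hmin _ (sideZ_mem hT hm2 hl) (by simp only; omega) ht p1.le le_rfl (Or.inl p1)
        rw [← this]; simp
    have fin : ∀ x ∈ T, (x.src = γ.src ∧ x.tgt = γ.tgt → x = γ) := by
      intro x _ h; exact arcZ_ext h.1 h.2
    rcases hcase with ⟨e1, e2⟩ | ⟨e1, e2⟩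
    · refine ⟨hγ, ⟨n, δ.tgt, by omega⟩, exch_of_cross hT hγ ?_ ?_⟩
      · unfold CrossZ; simp only; omega
      · intro x hx hc
        have q1 := hm1.2 x hx
        have q2 := hm2.2 x hx
        have q3 := hn1.2 x hx
        have q4 := hn2.2 x hx
        have q5 := hT.1 δ hδ x hx
        have := x.sep
        unfold CrossZ at hc q5; simp only at hc
        exact fin x hx (by omega)
    · refine ⟨hγ, ⟨δ.src, n, by omega⟩, exch_of_cross hT hγ ?_ ?_⟩
      · unfold CrossZ; simp only; omega
      · intro x hx hc
        have q1 := hm1.2 x hx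
        have q2 := hm2.2 x hx
        have q3 := hn1.2 x hx
        have q4 := hn2.2 x hx
        have q5 := hT.1 δ hδ x hx
        have := x.sep
        unfold CrossZ at hc q5; simp only at hc
        exact fin x hx (by omega)

/-- If `α ∈ T` is mutable, then `γ ∈ T` is mutable in `T` if and only if `μ_α(γ)` is mutable
in `μ_α(T)`. -/
theorem statement7 (T : Set ArcZ) (hT : IsTriangulationZ T) (α : ArcZ)
    (hα : IsMutableZ T α) (γ : ArcZ) (hγ : γ ∈ T) :
    IsMutableZ T γ ↔ IsMutableZ (mutateZ T α) (mutArcZ T α γ) := by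
  have hex : MutExchangeZ T α (flipArcZ T α) := by
    unfold flipArcZ
    rw [dif_pos hα.2]
    exact hα.2.choose_spec
  obtain ⟨hnot, hc, ho⟩ := cross_of_exch hT hα.1 hex
  unfold mutateZ mutArcZ
  set α' := flipArcZ T α
  obtain ⟨hne, hT'⟩ := hex
  have hback : ((T \ {α}) ∪ {α'}) \ {α'} ∪ {α} = T := by
    ext x
    simp only [Set.mem_union, Set.mem_diff, Set.mem_singleton_iff]
    constructor
    · rintro (⟨⟨h, _⟩ | h, h'⟩ | h)
      · exact h
      · exact absurd h h'
      · exact h ▸ hα.1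
    · intro h
      by_cases hx : x = α
      · exact Or.inr hx
      · exact Or.inl ⟨Or.inl ⟨h, hx⟩, fun e => hnot (e ▸ h)⟩
  have hα' : IsMutableZ ((T \ {α}) ∪ {α'}) α' :=
    ⟨Or.inr rfl, α, hne.symm, by rw [hback]; exact hT⟩
  by_cases hγα : γ = α
  · rw [if_pos hγα, hγα]
    exact ⟨fun _ => hα', fun _ => hα⟩
  · rw [if_neg hγα]
    have hγ' : γ ∈ (T \ {α}) ∪ {α'} := Or.inl ⟨hγ, hγα⟩
    have hγne : γ ≠ α' := fun h => hnot (h ▸ hγ)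
    rw [mutable_iff hT hγ, mutable_iff hT' hγ']
    constructor
    · rintro ⟨δ, hδ, h1, h2, h3⟩
      by_cases hδα : δ = α
      · subst hδα
        obtain ⟨ε, hε, k1, k2, k3⟩ := (mutable_iff hT hδ).1 hα
        refine ⟨ε, Or.inl ⟨hε, k1⟩, ?_, by omega, by omega⟩
        rintro rfl
        exact h1 (arcZ_ext (by omega) (by omega))
      · exact ⟨δ, Or.inl ⟨hδ, hδα⟩, h1, h2, h3⟩
    · rintro ⟨δ, hδ | hδ, h1, h2, h3⟩
      · exact ⟨δ, hδ.1, h1, h2, h3⟩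
      · have hδ : δ = α' := hδ
        obtain ⟨ε, hε, k1, k2, k3⟩ := (mutable_iff hT' hα'.1).1 hα'
        rw [← hδ] at k2 k3
        rcases hε with hε | hε
        · refine ⟨ε, hε.1, ?_, by omega, by omega⟩
          rintro rfl
          exact h1 (arcZ_ext (by omega) (by omega))
        · exact absurd hε k1
end
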